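/- arXiv:2103.16557 — 3 statements merged into one kernel-verified Lean document; each statement's English description precedes it below -/
import Mathlib

section
/- Let J be a small cofiltered category and F : J ⥤ TopCat a functor such that every space F(j) is a spectral space and every transition map F(f) is a spectral map. Let T be the limit of F in TopCat, with limit projections π_j : T → F(j). Suppose i is an object of J and U ⊆ F(i) is a quasi-compact open subset such that the image of π_i : T → F(i) is contained in U. Then there exist an object j of J and a morphism f : j → i in J such that the image of F(f) : F(j) → F(i) is contained in U. -/
open CategoryTheory CategoryTheory.Limits TopologicalSpace

/-- A topological space is spectral if it is quasi-compact, `T0`, quasi-sober,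
quasi-separated, and its quasi-compact open subsets form a basis of the topology. -/
def IsSpectralSpace (X : Type*) [TopologicalSpace X] : Prop :=
  CompactSpace X ∧ T0Space X ∧ QuasiSober X ∧ QuasiSeparatedSpace X ∧
    IsTopologicalBasis {U : Set X | IsOpen U ∧ IsCompact U}

theorem aux_t2 {X : Type*} [TopologicalSpace X] (h : IsSpectralSpace X) :
    T2Space (WithConstructibleTopology X) := by
  obtain ⟨_, ht0, _, _, hb⟩ := h
  have key : ∀ V : Set X, IsOpen V → IsCompact V →
      IsOpen (WithTopology.ofTopology (t := constructibleTopology X) ⁻¹' V) ∧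
      IsOpen (WithTopology.ofTopology (t := constructibleTopology X) ⁻¹' Vᶜ) := by
    intro V ho hc
    constructor
    · rw [WithConstructibleTopology.isOpen_iff]
      exact hc.isOpen_constructibleTopology_of_isOpen ho
    · rw [WithConstructibleTopology.isOpen_iff]
      refine IsCompact.isOpen_constructibleTopology_of_isClosed (s := Vᶜ) ?_ ho.isClosed_compl
      rwa [compl_compl]
  refine ⟨fun x y hxy => ?_⟩
  have hne : x.ofTopology ≠ y.ofTopology := fun h => hxy (WithTopology.ofTopology_injective _ h)
  obtain ⟨W, hW, hx⟩ := exists_isOpen_xor_mem hne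
  rcases hx with ⟨hx, hy⟩ | ⟨hy, hx⟩
  · obtain ⟨V, ⟨ho, hc⟩, hxV, hVW⟩ := hb.exists_subset_of_mem_open hx hW
    exact ⟨_, _, (key V ho hc).1, (key V ho hc).2, hxV, fun h => hy (hVW h),
      Set.disjoint_left.2 fun z h1 h2 => h2 h1⟩
  · obtain ⟨V, ⟨ho, hc⟩, hxV, hVW⟩ := hb.exists_subset_of_mem_open hy hW
    exact ⟨_, _, (key V ho hc).2, (key V ho hc).1, fun h => hx (hVW h), hxV,
      Set.disjoint_left.2 fun z h1 h2 => h1 h2⟩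

theorem aux_cont {X Y : Type*} [TopologicalSpace X] [TopologicalSpace Y] {f : X → Y}
    (hf : IsSpectralMap f) :
    Continuous (fun x : WithConstructibleTopology X =>
      (WithTopology.toTopology (constructibleTopology Y) (f x.ofTopology))) := by
  have : @Continuous _ _ (constructibleTopology X) (constructibleTopology Y) f := by
    refine continuous_generateFrom_iff.2 ?_
    rintro s (⟨ho, hc⟩ | ⟨hcl, hc⟩)
    · exact (hf.isCompact_preimage_of_isOpen ho hc).isOpen_constructibleTopology_of_isOpen
        (ho.preimage hf.toContinuous)
    · exact IsCompact.isOpen_constructibleTopology_of_isClosed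
        (hf.isCompact_preimage_of_isOpen hcl.isOpen_compl hc) (hcl.preimage hf.toContinuous)
  exact @Continuous.comp _ _ _ _ (constructibleTopology Y) _ _ _
    (WithTopology.continuous_toTopology _)
    (@Continuous.comp _ _ _ _ (constructibleTopology X) (constructibleTopology Y) _ _ this
      (WithTopology.continuous_ofTopology _))

/-- Let `T = lim F` be a cofiltered inverse limit of spectral spaces with spectral transition
maps.  If `U` is a quasi-compact open of `F.obj i` such that `π_i : T → F.obj i` has image
contained in `U`, then some transition map `F.map f : F.obj j → F.obj i` has image contained
in `U`. -/
theorem image_subset_of_limit_image_subset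
    {J : Type u} [SmallCategory J] [IsCofiltered J] (F : J ⥤ TopCat.{u})
    (hspec : ∀ j : J, IsSpectralSpace (F.obj j))
    (hmaps : ∀ {j j' : J} (f : j ⟶ j'), IsSpectralMap (F.map f))
    (i : J) (U : Set (F.obj i)) (hUopen : IsOpen U) (hUcomp : IsCompact U)
    (hT : Set.range (limit.π F i) ⊆ U) :
    ∃ (j : J) (f : j ⟶ i), Set.range (F.map f) ⊆ U := by
  by_contra! hcon
  have hne : ∀ (j : J) (f : j ⟶ i), ∃ x : F.obj j, F.map f x ∉ U := by
    intro j f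
    obtain ⟨_, ⟨x, rfl⟩, hx⟩ := Set.not_subset.1 (hcon j f)
    exact ⟨x, hx⟩
  have hmem : ∀ {f g : Over i} (a : f ⟶ g) (x : F.obj f.left), F.map f.hom x ∉ U →
      F.map g.hom (F.map a.left x) ∉ U := by
    intro f g a x hx h
    have e : F.map f.hom = F.map a.left ≫ F.map g.hom := by
      rw [← F.map_comp, Over.w a]
    rw [e] at hx
    exact hx h
  let G : Over i ⥤ TopCat.{u} :=
    { obj := fun f => TopCat.of {x : WithConstructibleTopology (F.obj f.left) //
        F.map f.hom x.ofTopology ∉ U}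
      map := fun {f g} a => TopCat.ofHom
        { toFun := fun x => ⟨WithTopology.toTopology _ (F.map a.left x.1.ofTopology),
            hmem a x.1.ofTopology x.2⟩
          continuous_toFun :=
            ((aux_cont (hmaps a.left)).comp continuous_subtype_val).subtype_mk _ }
      map_id := fun f => by
        ext x
        simp
      map_comp := fun a b => by
        ext x
        simp }
  have (f : Over i) : Nonempty (G.obj f) := by
    obtain ⟨x, hx⟩ := hne f.left f.hom
    exact ⟨⟨WithTopology.toTopology _ x, hx⟩⟩
  have (f : Over i) : T2Space (G.obj f) := by
    have := aux_t2 (hspec f.left)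
    have h : T2Space {x : WithConstructibleTopology (F.obj f.left) //
        F.map f.hom x.ofTopology ∉ U} := inferInstance
    exact h
  have (f : Over i) : CompactSpace (G.obj f) := by
    obtain ⟨_, _, _, _, hb⟩ := hspec f.left
    have : PrespectralSpace (F.obj f.left) := ⟨hb⟩
    have hcl : IsClosed {x : WithConstructibleTopology (F.obj f.left) |
        F.map f.hom x.ofTopology ∉ U} := by
      rw [← isOpen_compl_iff, WithConstructibleTopology.isOpen_iff]
      have := ((hmaps f.hom).isCompact_preimage_of_isOpen hUopen
        hUcomp).isOpen_constructibleTopology_of_isOpen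
          (hUopen.preimage (hmaps f.hom).toContinuous)
      convert this using 1
      ext x
      simp
    exact isCompact_iff_compactSpace.1 hcl.isCompact
  obtain ⟨⟨s, hs⟩⟩ := TopCat.nonempty_limitCone_of_compact_t2_cofiltered_system.{u} G
  let c : Cone (Over.forget i ⋙ F) :=
    { pt := TopCat.of PUnit
      π :=
        { app := fun f => TopCat.ofHom ⟨fun _ => (s f).1.ofTopology, continuous_const⟩
          naturality := fun f g a => by
            ext x
            have := congrArg (fun z => z.1.ofTopology) (hs a)
            exact this.symm } }
  let t : (limit F : TopCat.{u}) := limit.lift F (Functor.Initial.extendCone.obj c) PUnit.unit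
  have h1 : limit.π F i t ∈ U := hT ⟨t, rfl⟩
  have h2 : limit.π F i t = F.map (𝟙 i) (s (Over.mk (𝟙 i))).1.ofTopology := by
    have e := limit.lift_π (Functor.Initial.extendCone.obj c) i
    rw [Functor.Initial.extendCone_obj_π_app' (F := Over.forget i) c (X := Over.mk (𝟙 i)) (𝟙 i)] at e
    exact ConcreteCategory.congr_hom e PUnit.unit
  rw [h2] at h1
  exact (s (Over.mk (𝟙 i))).2 h1
end

section
/- Let R be a commutative ring and ϖ an element of R. Let A → B → C be homomorphisms of R-modules, f : A → B and g : B → C. Assume: (1) B is ϖ-torsionfree, i.e. multiplication by ϖ is injective on B; (2) the map A[1/ϖ] → B[1/ϖ] induced by f on localizations at the powers of ϖ is bijective; (3) the map A/ϖA → C/ϖC induced by g ∘ f is bijective. Then the map B/ϖB → C/ϖC induced by g is bijective. -/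
open Pointwise

/-- The map `M/ϖM → N/ϖN` induced on quotients by an `R`-linear map `f : M → N`,
where `ϖM` is the pointwise scalar multiple `ϖ • ⊤` of the full submodule. -/
def quotSMulTopMap {R : Type*} [CommRing R] (ϖ : R) {M N : Type*}
    [AddCommGroup M] [Module R M] [AddCommGroup N] [Module R N] (f : M →ₗ[R] N) :
    (M ⧸ (ϖ • ⊤ : Submodule R M)) →ₗ[R] (N ⧸ (ϖ • ⊤ : Submodule R N)) :=
  Submodule.mapQ _ _ f (by
    rintro x hx
    obtain ⟨y, -, rfl⟩ := Submodule.mem_map.mp hx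
    have : f (ϖ • y) ∈ (ϖ • (⊤ : Submodule R N) : Submodule R N) := by
      rw [map_smul]
      exact Submodule.smul_mem_pointwise_smul _ _ _ Submodule.mem_top
    exact this)

/-- Lemma 3.9: let `A → B → C` be maps of `R`-modules with `B` being `ϖ`-torsionfree.
If `f[1/ϖ] : A[1/ϖ] → B[1/ϖ]` and `(g ∘ f)/ϖ : A/ϖA → C/ϖC` are both bijective,
then `g/ϖ : B/ϖB → C/ϖC` is bijective. -/
theorem quot_bijective_of_comp_bijective
    {R : Type*} [CommRing R] (ϖ : R)
    {A B C : Type*} [AddCommGroup A] [Module R A] [AddCommGroup B] [Module R B]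
    [AddCommGroup C] [Module R C] (f : A →ₗ[R] B) (g : B →ₗ[R] C)
    (hB : ∀ b : B, ϖ • b = 0 → b = 0)
    (hloc : Function.Bijective (IsLocalizedModule.map (Submonoid.powers ϖ)
      (LocalizedModule.mkLinearMap (Submonoid.powers ϖ) A)
      (LocalizedModule.mkLinearMap (Submonoid.powers ϖ) B) f))
    (hgf : Function.Bijective (quotSMulTopMap ϖ (g ∘ₗ f))) :
    Function.Bijective (quotSMulTopMap ϖ g) := by
  have hmem : ∀ a : A, ∀ c : C, g (f a) = ϖ • c → ∃ a', a = ϖ • a' := by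
    intro a c h
    have h0 : quotSMulTopMap ϖ (g ∘ₗ f) (Submodule.Quotient.mk a) = 0 := by
      change Submodule.Quotient.mk (g (f a)) = _
      rw [Submodule.Quotient.mk_eq_zero, h]
      exact Submodule.smul_mem_pointwise_smul _ _ _ Submodule.mem_top
    have h1 := hgf.1 (h0.trans (map_zero _).symm)
    rw [Submodule.Quotient.mk_eq_zero] at h1
    obtain ⟨y, -, hy⟩ := Submodule.mem_map.mp h1
    exact ⟨y, hy.symm⟩
  have hpow : ∀ n : ℕ, ∀ b : B, ∀ a : A, f a = ϖ ^ n • b → ∃ a', f a' = b := by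
    intro n
    induction n with
    | zero => intro b a h; exact ⟨a, by simpa using h⟩
    | succ n ih =>
      intro b a h
      rw [pow_succ', mul_smul] at h
      obtain ⟨a', rfl⟩ := hmem a (g (ϖ ^ n • b)) (by rw [h, map_smul])
      refine ih b a' (sub_eq_zero.mp (hB _ ?_))
      rw [smul_sub, ← h, map_smul, sub_self]
  have hf : Function.Surjective f := by
    intro b
    obtain ⟨x, hx⟩ := hloc.2 (LocalizedModule.mkLinearMap (Submonoid.powers ϖ) B b)
    obtain ⟨⟨a, s⟩, hs⟩ := IsLocalizedModule.surj (Submonoid.powers ϖ)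
      (LocalizedModule.mkLinearMap (Submonoid.powers ϖ) A) x
    have h2 : LocalizedModule.mkLinearMap (Submonoid.powers ϖ) B (f a)
        = LocalizedModule.mkLinearMap (Submonoid.powers ϖ) B ((s : R) • b) := by
      rw [map_smul, ← hx, ← map_smul, ← IsLocalizedModule.map_apply (Submonoid.powers ϖ)
        (LocalizedModule.mkLinearMap (Submonoid.powers ϖ) A)]
      exact congrArg _ hs.symm
    obtain ⟨t, ht⟩ := (IsLocalizedModule.eq_iff_exists (Submonoid.powers ϖ)
      (LocalizedModule.mkLinearMap (Submonoid.powers ϖ) B)).mp h2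
    obtain ⟨_, n, rfl⟩ := s
    obtain ⟨_, m, rfl⟩ := t
    refine hpow (m + n) b (ϖ ^ m • a) ?_
    rw [map_smul, pow_add, mul_smul]
    exact ht
  constructor
  · rw [injective_iff_map_eq_zero]
    intro q hq
    obtain ⟨b, rfl⟩ := Submodule.Quotient.mk_surjective _ q
    obtain ⟨a, rfl⟩ := hf b
    change Submodule.Quotient.mk (g (f a)) = _ at hq
    rw [Submodule.Quotient.mk_eq_zero] at hq
    obtain ⟨c, -, hc⟩ := Submodule.mem_map.mp hq
    obtain ⟨a', rfl⟩ := hmem a c hc.symm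
    rw [Submodule.Quotient.mk_eq_zero, map_smul]
    exact Submodule.smul_mem_pointwise_smul _ _ _ Submodule.mem_top
  · intro q
    obtain ⟨p, hp⟩ := hgf.2 q
    obtain ⟨a, rfl⟩ := Submodule.Quotient.mk_surjective _ p
    exact ⟨Submodule.Quotient.mk (f a), hp⟩
end

section
/- Let R be a commutative ring and ϖ an element of R. Let f : A → B be a homomorphism of R-modules such that both A and B are ϖ-torsionfree. Assume that the induced map A[1/ϖ] → B[1/ϖ] on localizations at the powers of ϖ is bijective and that the induced map A/ϖA → B/ϖB is injective. Then f is bijective. -/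
open Pointwise

/-- If `f : A → B` is a map of `ϖ`-torsionfree `R`-modules which becomes bijective after
inverting `ϖ` and is injective modulo `ϖ`, then `f` is bijective. -/
theorem bijective_of_localized_bijective_of_quot_injective
    {R : Type*} [CommRing R] (ϖ : R)
    {A B : Type*} [AddCommGroup A] [Module R A] [AddCommGroup B] [Module R B]
    (f : A →ₗ[R] B)
    (hA : ∀ a : A, ϖ • a = 0 → a = 0)
    (hB : ∀ b : B, ϖ • b = 0 → b = 0)
    (hloc : Function.Bijective (IsLocalizedModule.map (Submonoid.powers ϖ)
      (LocalizedModule.mkLinearMap (Submonoid.powers ϖ) A)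
      (LocalizedModule.mkLinearMap (Submonoid.powers ϖ) B) f))
    (hquot : Function.Injective (quotSMulTopMap ϖ f)) :
    Function.Bijective f := by
  have hApow : ∀ (n : ℕ) (a : A), ϖ ^ n • a = 0 → a = 0 := by
    intro n
    induction n with
    | zero => intro a h; simpa using h
    | succ n ih =>
      intro a h
      rw [pow_succ, mul_smul] at h
      exact hA a (ih _ h)
  have key : ∀ (n : ℕ) (a : A) (b : B), f a = ϖ ^ n • b → ∃ a', f a' = b := by
    intro n
    induction n with
    | zero => intro a b h; exact ⟨a, by simpa using h⟩
    | succ n ih =>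
      intro a b h
      rw [pow_succ', mul_smul] at h
      have h0 : (Submodule.Quotient.mk a : A ⧸ (ϖ • ⊤ : Submodule R A)) = 0 := by
        apply hquot
        rw [map_zero]
        change (Submodule.Quotient.mk (f a) : B ⧸ (ϖ • ⊤ : Submodule R B)) = 0
        rw [Submodule.Quotient.mk_eq_zero, h]
        exact Submodule.smul_mem_pointwise_smul _ _ _ Submodule.mem_top
      rw [Submodule.Quotient.mk_eq_zero, Submodule.mem_smul_pointwise_iff_exists] at h0
      obtain ⟨a', -, rfl⟩ := h0
      refine ih a' b (sub_eq_zero.mp (hB _ ?_))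
      rw [smul_sub, ← map_smul, h, sub_self]
  constructor
  · rw [injective_iff_map_eq_zero]
    intro a ha
    have h : LocalizedModule.mkLinearMap (Submonoid.powers ϖ) A a =
        LocalizedModule.mkLinearMap (Submonoid.powers ϖ) A 0 := by
      apply hloc.1
      rw [IsLocalizedModule.map_apply, IsLocalizedModule.map_apply, ha, map_zero f]
    obtain ⟨⟨_, n, rfl⟩, hc⟩ := (IsLocalizedModule.eq_iff_exists (Submonoid.powers ϖ) _).mp h
    exact hApow n a (by simpa [Submonoid.smul_def] using hc)
  · intro b
    obtain ⟨x, hx⟩ := hloc.2 (LocalizedModule.mkLinearMap (Submonoid.powers ϖ) B b)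
    obtain ⟨⟨a, ⟨_, m, rfl⟩⟩, hs⟩ := IsLocalizedModule.surj (Submonoid.powers ϖ)
      (LocalizedModule.mkLinearMap (Submonoid.powers ϖ) A) x
    simp only [Submonoid.smul_def] at hs
    have h : LocalizedModule.mkLinearMap (Submonoid.powers ϖ) B (ϖ ^ m • b) =
        LocalizedModule.mkLinearMap (Submonoid.powers ϖ) B (f a) := by
      rw [← IsLocalizedModule.map_apply (Submonoid.powers ϖ)
        (LocalizedModule.mkLinearMap (Submonoid.powers ϖ) A), ← hs, map_smul, map_smul, hx]
    obtain ⟨⟨_, n, rfl⟩, hc⟩ := (IsLocalizedModule.eq_iff_exists (Submonoid.powers ϖ) _).mp h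
    simp only [Submonoid.smul_def] at hc
    refine key (n + m) (ϖ ^ n • a) b ?_
    rw [map_smul, pow_add, mul_smul]
    exact hc.symm
end
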